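/- Let y_1, …, y_ν ∈ ℝ³ contain at least two linearly independent vectors, let k_p, k_I > 0, set A = (k_p/2) Σ_{i=1}^{ν} y_{i×} y_{i×}, and let B : ℝ → SO(3) be continuously differentiable with sup_t ‖Ḃ(t)‖ < ∞. Then the origin of the linear time-varying system ẋ = A x + B(t)ᵀ θ, θ̇ = k_I B(t) ( Σ_{i=1}^{ν} y_{i×} y_{i×} ) x on ℝ³ × ℝ³ is uniformly globally exponentially stable: there exist k, γ > 0 such that every differentiable solution (x, θ) satisfies ‖(x(t), θ(t))‖ ≤ k e^{−γ (t − t₀)} ‖(x(t₀), θ(t₀))‖ for all t ≥ t₀ and all t₀ ∈ ℝ. -/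

import Mathlib

open Matrix

attribute [local instance] Matrix.frobeniusNormedAddCommGroup Matrix.frobeniusNormedSpace

noncomputable section

def skew3 (v : Fin 3 → ℝ) : Matrix (Fin 3) (Fin 3) ℝ :=
  !![0, -v 2, v 1; v 2, 0, -v 0; -v 1, v 0, 0]

def SO3 : Set (Matrix (Fin 3) (Fin 3) ℝ) := {R | Rᵀ * R = 1 ∧ R.det = 1}

theorem skew3_mulVec (v u : Fin 3 → ℝ) : skew3 v *ᵥ u = crossProduct v u := by
  ext i
  fin_cases i <;> simp [skew3, cross_apply, mulVec, dotProduct, Fin.sum_univ_three] <;> ring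

theorem skew3_transpose (v : Fin 3 → ℝ) : (skew3 v)ᵀ = -skew3 v := by
  ext i j
  fin_cases i <;> fin_cases j <;> simp [skew3]

theorem sum_skew3_sq_transpose {ν : ℕ} (y : Fin ν → Fin 3 → ℝ) :
    (∑ i, skew3 (y i) * skew3 (y i))ᵀ = ∑ i, skew3 (y i) * skew3 (y i) := by
  simp [transpose_sum, transpose_mul, skew3_transpose]

theorem dotProduct_sum_skew3_sq_mulVec {ν : ℕ} (y : Fin ν → Fin 3 → ℝ) (u : Fin 3 → ℝ) :
    u ⬝ᵥ ((∑ i, skew3 (y i) * skew3 (y i)) *ᵥ u) =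
      -∑ i, crossProduct (y i) u ⬝ᵥ crossProduct (y i) u := by
  rw [sum_mulVec, dotProduct_sum, ← Finset.sum_neg_distrib]
  refine Finset.sum_congr rfl fun i _ => ?_
  rw [← mulVec_mulVec, dotProduct_mulVec, ← mulVec_transpose, skew3_transpose, neg_mulVec,
    neg_dotProduct, skew3_mulVec]

theorem dotProduct_self_nonneg_real {n : ℕ} (u : Fin n → ℝ) : 0 ≤ u ⬝ᵥ u :=
  Finset.sum_nonneg fun _ _ => mul_self_nonneg _

/-- Young's inequality for the dot product. -/
theorem two_mul_dotProduct_le {n : ℕ} {c : ℝ} (hc : 0 < c) (u v : Fin n → ℝ) :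
    2 * (u ⬝ᵥ v) ≤ c * (u ⬝ᵥ u) + c⁻¹ * (v ⬝ᵥ v) := by
  simp only [dotProduct, Finset.mul_sum, ← Finset.sum_add_distrib]
  refine Finset.sum_le_sum fun i _ => ?_
  have h : c * (u i * u i) + c⁻¹ * (v i * v i) - 2 * (u i * v i) =
      c⁻¹ * (c * u i - v i) ^ 2 := by
    field_simp
    ring
  have : 0 ≤ c⁻¹ * (c * u i - v i) ^ 2 := by positivity
  linarith

theorem neg_two_mul_dotProduct_le {n : ℕ} {c : ℝ} (hc : 0 < c) (u v : Fin n → ℝ) :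
    -(2 * (u ⬝ᵥ v)) ≤ c * (u ⬝ᵥ u) + c⁻¹ * (v ⬝ᵥ v) := by
  simpa using two_mul_dotProduct_le hc u (-v)

theorem dotProduct_crossProduct_self_mul_le (a b u : Fin 3 → ℝ) :
    (crossProduct a b ⬝ᵥ crossProduct a b) * (u ⬝ᵥ u) ≤
      3 * (a ⬝ᵥ a + b ⬝ᵥ b) *
        (crossProduct a u ⬝ᵥ crossProduct a u + crossProduct b u ⬝ᵥ crossProduct b u) := by
  set c := crossProduct a b with hc
  set w := crossProduct a u with hw
  set z := crossProduct b u with hz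
  have lagrange (p q : Fin 3 → ℝ) : (p ⬝ᵥ p) * (q ⬝ᵥ q) =
      (p ⬝ᵥ q) ^ 2 + crossProduct p q ⬝ᵥ crossProduct p q := by
    simp [cross_apply, dotProduct, Fin.sum_univ_three]
    ring
  have hcu : c ⬝ᵥ u = a ⬝ᵥ z := by
    simp [hc, hz, cross_apply, dotProduct, Fin.sum_univ_three]
    ring
  have hJ : crossProduct c u = crossProduct a z - crossProduct b w := by
    ext i
    fin_cases i <;> simp [hc, hz, hw, cross_apply] <;> ring
  have h1 := lagrange c u
  have h2 := lagrange a z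
  have h3 := lagrange b w
  have h4 := neg_two_mul_dotProduct_le one_pos (crossProduct a z) (crossProduct b w)
  have h5 : crossProduct c u ⬝ᵥ crossProduct c u =
      crossProduct a z ⬝ᵥ crossProduct a z - 2 * (crossProduct a z ⬝ᵥ crossProduct b w) +
        crossProduct b w ⬝ᵥ crossProduct b w := by
    rw [hJ, sub_dotProduct, dotProduct_sub, dotProduct_sub,
      dotProduct_comm (crossProduct b w) (crossProduct a z)]
    ring
  have ha := dotProduct_self_nonneg_real a
  have hb := dotProduct_self_nonneg_real b
  have hw0 := dotProduct_self_nonneg_real w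
  have hz0 := dotProduct_self_nonneg_real z
  have haz := dotProduct_self_nonneg_real (crossProduct a z)
  have hbw := dotProduct_self_nonneg_real (crossProduct b w)
  rw [hcu] at h1
  rw [inv_one] at h4
  nlinarith [mul_nonneg ha hw0, mul_nonneg hb hz0, mul_nonneg ha hz0, mul_nonneg hb hw0,
    sq_nonneg (a ⬝ᵥ z), sq_nonneg (b ⬝ᵥ w)]

theorem exists_pos_mul_dotProduct_self_le {ν : ℕ} {y : Fin ν → Fin 3 → ℝ}
    (hindep : ∃ i j : Fin ν, LinearIndependent ℝ ![y i, y j]) :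
    ∃ p > (0 : ℝ), ∀ u : Fin 3 → ℝ,
      p * (u ⬝ᵥ u) ≤ -(u ⬝ᵥ ((∑ i, skew3 (y i) * skew3 (y i)) *ᵥ u)) := by
  obtain ⟨i, j, hij⟩ := hindep
  have hne : i ≠ j := by
    rintro rfl
    have := hij.injective (a₁ := 0) (a₂ := 1) (by simp)
    simp at this
  have hc0 : 0 < crossProduct (y i) (y j) ⬝ᵥ crossProduct (y i) (y j) :=
    (dotProduct_self_nonneg_real _).lt_of_ne' fun h =>
      (crossProduct_ne_zero_iff_linearIndependent.2 hij) (dotProduct_self_eq_zero.1 h)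
  have ha : 0 < y i ⬝ᵥ y i := (dotProduct_self_nonneg_real _).lt_of_ne' fun h =>
    hij.ne_zero 0 (dotProduct_self_eq_zero.1 h)
  have hd : 0 < 3 * (y i ⬝ᵥ y i + y j ⬝ᵥ y j) := by
    have := dotProduct_self_nonneg_real (y j)
    positivity
  refine ⟨_, div_pos hc0 hd, fun u => ?_⟩
  rw [dotProduct_sum_skew3_sq_mulVec, neg_neg, div_mul_eq_mul_div, div_le_iff₀ hd, mul_comm _ (3 * _)]
  refine (dotProduct_crossProduct_self_mul_le _ _ u).trans
    (mul_le_mul_of_nonneg_left ?_ hd.le)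
  rw [← Finset.sum_pair (f := fun k => crossProduct (y k) u ⬝ᵥ crossProduct (y k) u) hne]
  exact Finset.sum_le_sum_of_subset_of_nonneg (Finset.subset_univ _)
    fun _ _ _ => dotProduct_self_nonneg_real _

theorem mulVec_dotProduct_self_le {n : ℕ} (C : Matrix (Fin n) (Fin n) ℝ) (v : Fin n → ℝ) :
    C *ᵥ v ⬝ᵥ C *ᵥ v ≤ ‖C‖ ^ 2 * (v ⬝ᵥ v) := by
  have hC : ‖C‖ ^ 2 = ∑ i, ∑ j, C i j ^ 2 := by
    rw [frobenius_norm_def, ← Real.rpow_natCast, ← Real.rpow_mul (by positivity)]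
    simp
  rw [hC, Finset.sum_mul]
  refine Finset.sum_le_sum fun i _ => ?_
  simpa [mulVec, dotProduct, sq] using
    Finset.sum_mul_sq_le_sq_mul_sq Finset.univ (C i) v

theorem HasDerivAt.dotProduct {n : ℕ} {f g : ℝ → Fin n → ℝ} {f' g' : Fin n → ℝ} {t : ℝ}
    (hf : HasDerivAt f f' t) (hg : HasDerivAt g g' t) :
    HasDerivAt (fun s => f s ⬝ᵥ g s) (f' ⬝ᵥ g t + f t ⬝ᵥ g') t := by
  simp only [_root_.dotProduct, ← Finset.sum_add_distrib]
  exact HasDerivAt.fun_sum fun i _ => (hasDerivAt_pi.1 hf i).mul (hasDerivAt_pi.1 hg i)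

theorem HasDerivAt.matrix_transpose_mulVec {n : ℕ} {C : ℝ → Matrix (Fin n) (Fin n) ℝ}
    {C' : Matrix (Fin n) (Fin n) ℝ} {g : ℝ → Fin n → ℝ} {g' : Fin n → ℝ} {t : ℝ}
    (hC : HasDerivAt C C' t) (hg : HasDerivAt g g' t) :
    HasDerivAt (fun s => (C s)ᵀ *ᵥ g s) (C'ᵀ *ᵥ g t + (C t)ᵀ *ᵥ g') t := by
  refine hasDerivAt_pi.2 fun i => HasDerivAt.dotProduct (hasDerivAt_pi.2 fun j => ?_) hg
  exact (LinearMap.toContinuousLinearMap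
    (entryLinearMap ℝ ℝ j i : Matrix (Fin n) (Fin n) ℝ →ₗ[ℝ] ℝ)).hasFDerivAt.comp_hasDerivAt t hC

theorem sq_norm_le_dotProduct_self {n : ℕ} (u : Fin n → ℝ) : ‖u‖ ^ 2 ≤ u ⬝ᵥ u := by
  have h0 := dotProduct_self_nonneg_real u
  refine Real.le_sqrt (norm_nonneg u) h0 |>.1 ?_
  refine (pi_norm_le_iff_of_nonneg (Real.sqrt_nonneg _)).2 fun i => Real.abs_le_sqrt ?_
  rw [sq]
  exact Finset.single_le_sum (f := fun i => u i * u i) (fun _ _ => mul_self_nonneg _)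
    (Finset.mem_univ i)

theorem dotProduct_self_le_mul_sq_norm {n : ℕ} (u : Fin n → ℝ) : u ⬝ᵥ u ≤ n * ‖u‖ ^ 2 := by
  have : ∀ i ∈ Finset.univ, u i * u i ≤ ‖u‖ ^ 2 := fun i _ => by
    rw [← sq, ← sq_abs]
    exact pow_le_pow_left₀ (abs_nonneg _) (norm_le_pi_norm u i) 2
  simpa [dotProduct] using Finset.sum_le_sum this

/-- A scalar differential inequality `V' ≤ -γ V` forces exponential decay. -/
theorem le_exp_mul_of_hasDerivAt_le {V V' : ℝ → ℝ} {γ : ℝ}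
    (hV : ∀ t, HasDerivAt V (V' t) t) (hle : ∀ t, V' t ≤ -γ * V t) {t₀ t : ℝ} (ht : t₀ ≤ t) :
    V t ≤ Real.exp (-γ * (t - t₀)) * V t₀ := by
  have hd (s : ℝ) : HasDerivAt (fun s => Real.exp (γ * s) * V s)
      (Real.exp (γ * s) * (γ * 1) * V s + Real.exp (γ * s) * V' s) s :=
    (((hasDerivAt_id s).const_mul γ).exp).mul (hV s)
  have hanti : Antitone fun s => Real.exp (γ * s) * V s :=
    antitone_of_hasDerivAt_nonpos hd fun s => by
      have := mul_le_mul_of_nonneg_left (hle s) (Real.exp_pos (γ * s)).le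
      simp only [Pi.zero_apply]
      linarith
  have h := hanti ht
  have e : Real.exp (-γ * (t - t₀)) = Real.exp (γ * t₀) / Real.exp (γ * t) := by
    rw [← Real.exp_sub]
    ring_nf
  rw [e, div_mul_eq_mul_div, le_div_iff₀ (Real.exp_pos _)]
  linarith [h]

/-- **Uniform exponential stability of the linearization at the identity equilibrium.**
With `A = (k_p/2) Σ yᵢ× yᵢ×` (two of the `yᵢ` linearly independent) and `B(t) ∈ SO(3)`
continuously differentiable with uniformly bounded derivative, the origin of
`ẋ = Ax + B(t)ᵀθ`, `θ̇ = k_I B(t)(Σ yᵢ× yᵢ×) x` is uniformly globally exponentially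
stable. -/
theorem linearization_uniform_exponential_stability
    (ν : ℕ) (y : Fin ν → Fin 3 → ℝ)
    (hindep : ∃ i j : Fin ν, LinearIndependent ℝ ![y i, y j])
    (kp kI : ℝ) (hkp : 0 < kp) (hkI : 0 < kI)
    (A : Matrix (Fin 3) (Fin 3) ℝ)
    (hA : A = (kp / 2) • ∑ i, skew3 (y i) * skew3 (y i))
    (B B' : ℝ → Matrix (Fin 3) (Fin 3) ℝ)
    (hB : ∀ t, B t ∈ SO3)
    (hBdiff : ∀ t, HasDerivAt B (B' t) t)
    (hB'cont : Continuous B')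
    (hB'bdd : ∃ M : ℝ, ∀ t, ‖B' t‖ ≤ M) :
    ∃ k > (0 : ℝ), ∃ γ > (0 : ℝ),
      ∀ x θ : ℝ → Fin 3 → ℝ,
        (∀ t, HasDerivAt x (A *ᵥ x t + (B t)ᵀ *ᵥ θ t) t) →
        (∀ t, HasDerivAt θ (kI • (B t *ᵥ ((∑ i, skew3 (y i) * skew3 (y i)) *ᵥ x t))) t) →
        ∀ t₀ t : ℝ, t₀ ≤ t →
          ‖(x t, θ t)‖ ≤ k * Real.exp (-γ * (t - t₀)) * ‖(x t₀, θ t₀)‖ := by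
  obtain ⟨p, hp, hcoer⟩ := exists_pos_mul_dotProduct_self_le hindep
  have hsymm := sum_skew3_sq_transpose y
  set Q := ∑ i, skew3 (y i) * skew3 (y i) with hQ
  obtain ⟨M, hM⟩ := hB'bdd
  obtain ⟨N, hN1, hN2, hN3⟩ : ∃ N : ℝ, 1 ≤ N ∧ 1 ≤ N * (kI * p) ∧
      kp ^ 2 / 4 + (M ^ 2 + 1) / p ^ 2 + kI / p + 1 / 2 ≤ N * (kp * kI) := by
    refine ⟨max 1 (max (1 / (kI * p))
      ((kp ^ 2 / 4 + (M ^ 2 + 1) / p ^ 2 + kI / p + 1 / 2) / (kp * kI))), le_max_left _ _, ?_, ?_⟩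
    · rw [← div_le_iff₀ (by positivity)]
      exact (le_max_left _ _).trans (le_max_right _ _)
    · rw [← div_le_iff₀ (by positivity)]
      exact (le_max_right _ _).trans (le_max_right _ _)
  have hN0 : 0 < N := by linarith
  obtain ⟨C, hC0, hC1, hC2⟩ : ∃ C : ℝ, 0 < C ∧ N * (kI / p) + 1 / (2 * p ^ 2) ≤ C ∧
      N + 1 / 2 ≤ C :=
    ⟨N * (kI / p) + 1 / (2 * p ^ 2) + (N + 1 / 2), by positivity,
      le_add_of_nonneg_right (by positivity), le_add_of_nonneg_left (by positivity)⟩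
  set D := ‖Q‖ ^ 2 + 1 with hD
  have hD1 : 1 ≤ D := by simp [hD]
  refine ⟨Real.sqrt (12 * (C * D)), by positivity, 1 / (4 * C), by positivity, ?_⟩
  intro x θ hx hθ t₀ t ht
  have hS (v : Fin 3 → ℝ) : -(v ⬝ᵥ Q *ᵥ v) ≤ (Q *ᵥ v ⬝ᵥ Q *ᵥ v) / p := by
    have h1 := neg_two_mul_dotProduct_le hp v (Q *ᵥ v)
    have h2 := hcoer v
    rw [div_eq_inv_mul]
    linarith
  have hX (v : Fin 3 → ℝ) : v ⬝ᵥ v ≤ (Q *ᵥ v ⬝ᵥ Q *ᵥ v) / p ^ 2 := by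
    have h := (hcoer v).trans (hS v)
    rw [le_div_iff₀ hp] at h
    rw [le_div_iff₀ (by positivity)]
    linarith
  have hBorth (s : ℝ) (v : Fin 3 → ℝ) : B s *ᵥ v ⬝ᵥ B s *ᵥ v = v ⬝ᵥ v := by
    rw [dotProduct_mulVec, ← mulVec_transpose, mulVec_mulVec, (hB s).1, one_mulVec]
  have hBorth' (s : ℝ) (v : Fin 3 → ℝ) : (B s)ᵀ *ᵥ v ⬝ᵥ (B s)ᵀ *ᵥ v = v ⬝ᵥ v := by
    rw [dotProduct_mulVec, ← mulVec_transpose, mulVec_mulVec, transpose_transpose,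
      mul_eq_one_comm.1 (hB s).1, one_mulVec]
  set u : ℝ → Fin 3 → ℝ := fun s => (B s)ᵀ *ᵥ θ s with hu
  set g : ℝ → Fin 3 → ℝ := fun s => Q *ᵥ x s with hg
  set w : ℝ → Fin 3 → ℝ := fun s => (B' s)ᵀ *ᵥ θ s with hw
  have hx' (s : ℝ) : HasDerivAt x ((kp / 2) • g s + u s) s := by
    simpa [hA, smul_mulVec, hg, hu] using hx s
  have hg' (s : ℝ) : HasDerivAt g (Q *ᵥ ((kp / 2) • g s + u s)) s := by
    simpa [hsymm] using (hasDerivAt_const s Qᵀ).matrix_transpose_mulVec (hx' s)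
  have hu' (s : ℝ) : HasDerivAt u (w s + kI • g s) s := by
    have h := (hBdiff s).matrix_transpose_mulVec (hθ s)
    rwa [mulVec_smul, mulVec_mulVec, (hB s).1, one_mulVec] at h
  set V : ℝ → ℝ := fun s => N * (-kI * (x s ⬝ᵥ g s) + θ s ⬝ᵥ θ s) - x s ⬝ᵥ u s with hVdef
  set V' : ℝ → ℝ := fun s => -(N * (kp * kI)) * (g s ⬝ᵥ g s) - kp / 2 * (g s ⬝ᵥ u s)
    - θ s ⬝ᵥ θ s - x s ⬝ᵥ w s - kI * (x s ⬝ᵥ g s) with hV'def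
  have hV (s : ℝ) : HasDerivAt V (V' s) s := by
    have h := (((((hx' s).dotProduct (hg' s)).const_mul (-kI)).add
      ((hθ s).dotProduct (hθ s))).const_mul N).sub ((hx' s).dotProduct (hu' s))
    refine h.congr_deriv ?_
    have e1 (v : Fin 3 → ℝ) : x s ⬝ᵥ Q *ᵥ v = g s ⬝ᵥ v := by
      rw [dotProduct_mulVec, ← mulVec_transpose, hsymm]
    have e2 : θ s ⬝ᵥ B s *ᵥ g s = g s ⬝ᵥ u s := by
      rw [dotProduct_mulVec, ← mulVec_transpose, dotProduct_comm]
    have e3 : B s *ᵥ g s ⬝ᵥ θ s = g s ⬝ᵥ u s := by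
      rw [dotProduct_comm, e2]
    have e4 : u s ⬝ᵥ u s = θ s ⬝ᵥ θ s := hBorth' s (θ s)
    have e5 : Q *ᵥ x s = g s := rfl
    rw [e1, e5]
    simp only [add_dotProduct, dotProduct_add, smul_dotProduct, dotProduct_smul, smul_eq_mul,
      e2, e3, e4, dotProduct_comm (u s) (g s), hV'def]
    ring
  have hu2 (s : ℝ) : u s ⬝ᵥ u s = θ s ⬝ᵥ θ s := hBorth' s (θ s)
  have hdecay (s : ℝ) : V' s ≤ -(1 / 2) * (g s ⬝ᵥ g s + θ s ⬝ᵥ θ s) := by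
    have hM1 : 0 < M ^ 2 + 1 := by positivity
    have h1 := neg_two_mul_dotProduct_le (c := kp) hkp (g s) (u s)
    have h2 := neg_two_mul_dotProduct_le (c := 2 * (M ^ 2 + 1)) (by positivity) (x s) (w s)
    have h3 : w s ⬝ᵥ w s ≤ (M ^ 2 + 1) * (θ s ⬝ᵥ θ s) := by
      refine (mulVec_dotProduct_self_le _ _).trans
        (mul_le_mul_of_nonneg_right ?_ (dotProduct_self_nonneg_real _))
      rw [frobenius_norm_transpose]
      have := pow_le_pow_left₀ (norm_nonneg (B' s)) (hM s) 2
      linarith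
    have h4 : (2 * (M ^ 2 + 1))⁻¹ * (w s ⬝ᵥ w s) ≤ 1 / 2 * (θ s ⬝ᵥ θ s) := by
      rw [inv_mul_le_iff₀ (by positivity)]
      linarith
    have h5 : -(kp / 2 * (g s ⬝ᵥ u s)) ≤ kp ^ 2 / 4 * (g s ⬝ᵥ g s) + 1 / 4 * (θ s ⬝ᵥ θ s) := by
      have := mul_le_mul_of_nonneg_left h1 (a := kp / 4) (by positivity)
      rw [hu2, mul_add, ← mul_assoc (kp / 4) kp⁻¹, show kp / 4 * kp⁻¹ = 1 / 4 by field_simp] at this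
      linarith
    have h6 := mul_le_mul_of_nonneg_left (hX (x s)) hM1.le
    have h7 := mul_le_mul_of_nonneg_left (hS (x s)) hkI.le
    have h8 := mul_le_mul_of_nonneg_right hN3 (dotProduct_self_nonneg_real (g s))
    have e6 : (M ^ 2 + 1) * ((g s ⬝ᵥ g s) / p ^ 2) = (M ^ 2 + 1) / p ^ 2 * (g s ⬝ᵥ g s) := by ring
    have e7 : kI * ((g s ⬝ᵥ g s) / p) = kI / p * (g s ⬝ᵥ g s) := by ring
    change _ ≤ (M ^ 2 + 1) * ((g s ⬝ᵥ g s) / p ^ 2) at h6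
    change kI * -(x s ⬝ᵥ g s) ≤ kI * ((g s ⬝ᵥ g s) / p) at h7
    rw [e6] at h6
    rw [e7] at h7
    simp only [hV'def]
    linarith
  have hlower (s : ℝ) : 1 / 2 * (x s ⬝ᵥ x s + θ s ⬝ᵥ θ s) ≤ V s := by
    have h1 := two_mul_dotProduct_le one_pos (x s) (u s)
    have h2 := mul_le_mul_of_nonneg_left (hcoer (x s)) (mul_pos hN0 hkI).le
    have h3 := mul_le_mul_of_nonneg_right hN2 (dotProduct_self_nonneg_real (x s))
    have h4 := mul_le_mul_of_nonneg_right hN1 (dotProduct_self_nonneg_real (θ s))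
    change _ ≤ N * kI * -(x s ⬝ᵥ g s) at h2
    rw [hu2, inv_one] at h1
    simp only [hVdef]
    linarith
  have hupper (s : ℝ) : V s ≤ C * (g s ⬝ᵥ g s + θ s ⬝ᵥ θ s) := by
    have h1 := neg_two_mul_dotProduct_le one_pos (x s) (u s)
    have h2 := mul_le_mul_of_nonneg_left (hS (x s)) (mul_pos hN0 hkI).le
    have h3 := mul_le_mul_of_nonneg_right hC1 (dotProduct_self_nonneg_real (g s))
    have h4 := mul_le_mul_of_nonneg_right hC2 (dotProduct_self_nonneg_real (θ s))
    have h5 := hX (x s)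
    change N * kI * -(x s ⬝ᵥ g s) ≤ N * kI * ((g s ⬝ᵥ g s) / p) at h2
    change _ ≤ (g s ⬝ᵥ g s) / p ^ 2 at h5
    have e : (N * (kI / p) + 1 / (2 * p ^ 2)) * (g s ⬝ᵥ g s) =
        N * kI * ((g s ⬝ᵥ g s) / p) + 1 / 2 * ((g s ⬝ᵥ g s) / p ^ 2) := by
      field_simp
    rw [hu2, inv_one] at h1
    rw [e] at h3
    simp only [hVdef]
    linarith
  have hVt := le_exp_mul_of_hasDerivAt_le (γ := 1 / (2 * C)) hV (fun s => by
    refine (hdecay s).trans ?_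
    have h := mul_le_mul_of_nonneg_left (hupper s) (a := 1 / (2 * C)) (by positivity)
    have e : 1 / (2 * C) * (C * (g s ⬝ᵥ g s + θ s ⬝ᵥ θ s)) =
        1 / 2 * (g s ⬝ᵥ g s + θ s ⬝ᵥ θ s) := by
      field_simp
    linarith) ht
  have hnorm : ‖(x t, θ t)‖ ^ 2 ≤ x t ⬝ᵥ x t + θ t ⬝ᵥ θ t := by
    have h1 := sq_norm_le_dotProduct_self (x t)
    have h2 := sq_norm_le_dotProduct_self (θ t)
    have h3 := sq_nonneg ‖x t‖
    have h4 := sq_nonneg ‖θ t‖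
    rw [Prod.norm_def]
    rcases max_choice ‖x t‖ ‖θ t‖ with h | h <;> simp only [h] <;> linarith
  have hinit : V t₀ ≤ 6 * (C * D) * ‖(x t₀, θ t₀)‖ ^ 2 := by
    have h1 := mulVec_dotProduct_self_le Q (x t₀)
    have h2 := pow_le_pow_left₀ (norm_nonneg _) (norm_fst_le (x t₀, θ t₀)) 2
    have h3 := pow_le_pow_left₀ (norm_nonneg _) (norm_snd_le (x t₀, θ t₀)) 2
    have h4 := dotProduct_self_le_mul_sq_norm (x t₀)
    have h5 := dotProduct_self_le_mul_sq_norm (θ t₀)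
    have h6 := dotProduct_self_nonneg_real (x t₀)
    have h7 := mul_le_mul_of_nonneg_right hD1 (dotProduct_self_nonneg_real (θ t₀))
    push_cast at h4 h5
    have h8 : x t₀ ⬝ᵥ x t₀ + θ t₀ ⬝ᵥ θ t₀ ≤ 6 * ‖(x t₀, θ t₀)‖ ^ 2 := by linarith
    have h9 := mul_le_mul_of_nonneg_left h8 (a := D) (by positivity)
    have h10 : g t₀ ⬝ᵥ g t₀ + θ t₀ ⬝ᵥ θ t₀ ≤ D * (6 * ‖(x t₀, θ t₀)‖ ^ 2) := by
      change g t₀ ⬝ᵥ g t₀ ≤ _ at h1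
      have e : D * (x t₀ ⬝ᵥ x t₀) = ‖Q‖ ^ 2 * (x t₀ ⬝ᵥ x t₀) + x t₀ ⬝ᵥ x t₀ := by
        rw [hD]
        ring
      linarith
    have h11 := mul_le_mul_of_nonneg_left h10 hC0.le
    linarith [hupper t₀]
  refine le_of_sq_le_sq ?_ (by positivity)
  rw [mul_pow, mul_pow, Real.sq_sqrt (by positivity), ← Real.exp_nat_mul]
  have e : ((2 : ℕ) : ℝ) * (-(1 / (4 * C)) * (t - t₀)) = -(1 / (2 * C)) * (t - t₀) := by
    push_cast
    field_simp
    ring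
  rw [e]
  have h := mul_le_mul_of_nonneg_left hinit (Real.exp_pos (-(1 / (2 * C)) * (t - t₀))).le
  linarith [hlower t]
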